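/- arXiv:1311.0562 — 5 statements merged into one kernel-verified Lean document; each statement's English description precedes it below -/
import Mathlib

section
/- Let X be a real-valued random variable on a probability space (Ω, 𝒜, P). Then E[F^mid(X; X)] = 1/2, where F^mid is the mid-distribution function of X. -/
open MeasureTheory Set

/-- The mid-distribution function of a random variable `X` with respect to `P`:
`F^mid(x;X) = P(X ≤ x) − P(X = x)/2`. -/
noncomputable def midDistrib {Ω : Type*} [MeasurableSpace Ω] (P : Measure Ω)
    (X : Ω → ℝ) (x : ℝ) : ℝ :=
  (P (X ⁻¹' Iic x)).toReal - (P (X ⁻¹' {x})).toReal / 2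

/-- For any real-valued random variable `X` on a probability space,
`E[F^mid(X;X)] = 1/2`. -/
theorem expectation_midDistrib_eq_half {Ω : Type*} [MeasurableSpace Ω]
    (P : Measure Ω) [IsProbabilityMeasure P] (X : Ω → ℝ) (hX : Measurable X) :
    ∫ ω, midDistrib P X (X ω) ∂P = 1 / 2 := by
  have m1 : Measurable fun p : Ω × Ω => X p.1 := hX.comp measurable_fst
  have m2 : Measurable fun p : Ω × Ω => X p.2 := hX.comp measurable_snd
  let A : Set (Ω × Ω) := {p | X p.2 ≤ X p.1}
  let B : Set (Ω × Ω) := {p | X p.2 = X p.1}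
  have hA : MeasurableSet A := measurableSet_le m2 m1
  have hB : MeasurableSet B := measurableSet_eq_fun m2 m1
  let g : Ω × Ω → ℝ := fun p => A.indicator (fun _ => (1 : ℝ)) p - B.indicator (fun _ => (1 : ℝ)) p / 2
  have iA : Integrable (A.indicator (fun _ => (1 : ℝ))) (P.prod P) :=
    (integrable_const 1).indicator hA
  have iB : Integrable (B.indicator (fun _ => (1 : ℝ))) (P.prod P) :=
    (integrable_const 1).indicator hB
  have hg : Integrable g (P.prod P) := iA.sub (iB.div_const 2)
  have key : ∀ ω, midDistrib P X (X ω) = ∫ ω', g (ω, ω') ∂P := by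
    intro ω
    have sA : MeasurableSet (X ⁻¹' Iic (X ω)) := hX measurableSet_Iic
    have sB : MeasurableSet (X ⁻¹' {X ω}) := hX (measurableSet_singleton _)
    have e : (fun ω' => g (ω, ω')) = fun ω' =>
        (X ⁻¹' Iic (X ω)).indicator (fun _ => (1 : ℝ)) ω'
          - (X ⁻¹' {X ω}).indicator (fun _ => (1 : ℝ)) ω' / 2 := by
      funext ω'
      simp [g, A, B, indicator]
    rw [e, integral_sub ((integrable_const 1).indicator sA)
      (((integrable_const 1).indicator sB).div_const 2), integral_div,
      integral_indicator_const _ sA, integral_indicator_const _ sB]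
    simp [midDistrib, Measure.real]
  have e1 : ∫ ω, midDistrib P X (X ω) ∂P = ∫ p, g p ∂(P.prod P) := by
    rw [integral_prod _ hg]
    exact integral_congr_ae (Filter.Eventually.of_forall key)
  have e2 : ∫ p, g p.swap ∂(P.prod P) = ∫ p, g p ∂(P.prod P) := integral_prod_swap g
  have e3 : ∫ p, (g p + g p.swap) ∂(P.prod P) = 1 := by
    have : (fun p => g p + g p.swap) = fun _ => (1 : ℝ) := by
      funext p
      rcases lt_trichotomy (X p.1) (X p.2) with h | h | h
      · simp [g, A, B, indicator, h.le, h.not_ge, h.ne, h.ne']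
      · simp [g, A, B, indicator, h]
        norm_num
      · simp [g, A, B, indicator, h.le, h.not_ge, h.ne, h.ne']
    rw [this]
    simp
  have hs : Integrable (fun p : Ω × Ω => g p.swap) (P.prod P) := hg.swap
  rw [integral_add hg hs, e2] at e3
  rw [e1]
  linarith
end

section
/- Let X be a real-valued random variable on a probability space (Ω, 𝒜, P). Then Var[F^mid(X; X)] = (1/12)(1 − ∑_x p(x;X)³), where the sum runs over the (countably many) atoms x of the law of X; equivalently, Var[F^mid(X;X)] = (1/12)(1 − E[p(X;X)²]). -/
open MeasureTheory Set

namespace MidAux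

open Classical in
/-- comparison kernel -/
noncomputable def k (x y : ℝ) : ℝ := if y < x then 1 else if y = x then 1 / 2 else 0

open Classical in
/-- diagonal kernel -/
noncomputable def d (x y : ℝ) : ℝ := if y = x then 1 else 0

lemma k_meas : Measurable (fun q : ℝ × ℝ => k q.1 q.2) := by
  unfold k
  refine Measurable.ite (measurableSet_lt measurable_snd measurable_fst) measurable_const ?_
  exact Measurable.ite (measurableSet_eq_fun measurable_snd measurable_fst)
    measurable_const measurable_const

lemma d_meas : Measurable (fun q : ℝ × ℝ => d q.1 q.2) := by
  unfold d
  exact Measurable.ite (measurableSet_eq_fun measurable_snd measurable_fst)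
    measurable_const measurable_const

lemma k_nonneg (x y : ℝ) : 0 ≤ k x y := by unfold k; split_ifs <;> norm_num
lemma k_le (x y : ℝ) : k x y ≤ 1 := by unfold k; split_ifs <;> norm_num
lemma d_nonneg (x y : ℝ) : 0 ≤ d x y := by unfold d; split_ifs <;> norm_num
lemma d_le (x y : ℝ) : d x y ≤ 1 := by unfold d; split_ifs <;> norm_num

lemma k_add (x y : ℝ) : k x y + k y x = 1 := by
  unfold k
  rcases lt_trichotomy x y with h | h | h
  · simp [h, h.not_gt, h.ne']
  · subst h; norm_num
  · simp [h, h.not_gt, h.ne']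

lemma k_three (x y z : ℝ) :
    k x y * k x z + k y x * k y z + k z x * k z y = 1 - 1 / 4 * (d x y * d x z) := by
  unfold k d
  rcases lt_trichotomy x y with h | h | h <;> rcases lt_trichotomy y z with h' | h' | h' <;>
    rcases lt_trichotomy x z with h'' | h'' | h'' <;>
    first
    | (exfalso; linarith)
    | (simp [h, h', h'', h.not_gt, h'.not_gt, h''.not_gt, h.ne, h'.ne, h''.ne, h.ne', h'.ne', h''.ne'])
    | (subst h; simp [h', h'.not_gt, h'.ne, h'.ne']; done)
    | (subst h; simp [h', h'.not_gt, h'.ne, h'.ne']; norm_num; done)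
    | (subst h'; simp [h, h.not_gt, h.ne, h.ne']; done)
    | (subst h'; simp [h, h.not_gt, h.ne, h.ne']; norm_num; done)
    | (subst h''; simp [h, h.not_gt, h.ne, h.ne']; done)
    | (subst h''; simp [h, h.not_gt, h.ne, h.ne']; norm_num; done)
    | (subst h; subst h'; norm_num; done)

lemma integ {α : Type*} [MeasurableSpace α] (μ : Measure α) [IsFiniteMeasure μ] {f : α → ℝ}
    (hf : Measurable f) (h0 : ∀ x, 0 ≤ f x) (h1 : ∀ x, f x ≤ 1) : Integrable f μ :=
  Integrable.of_bound hf.aestronglyMeasurable 1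
    (Filter.Eventually.of_forall fun x => by rw [Real.norm_eq_abs, abs_of_nonneg (h0 x)]; exact h1 x)

variable (μ : Measure ℝ) [IsProbabilityMeasure μ]

lemma int_d (x : ℝ) : ∫ y, d x y ∂μ = μ.real {x} := by
  have : (fun y => d x y) = Set.indicator {x} (fun _ => (1 : ℝ)) := by
    ext y; simp [d, Set.indicator]
  rw [this, integral_indicator (measurableSet_singleton x)]; simp [Measure.real]

lemma int_k (x : ℝ) : ∫ y, k x y ∂μ = μ.real (Iic x) - μ.real {x} / 2 := by
  have : (fun y => k x y) = fun y => Set.indicator (Iic x) (fun _ => (1 : ℝ)) y - 1 / 2 * d x y := by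
    ext y
    rcases lt_trichotomy y x with h | h | h
    · simp [k, d, h, h.le, h.ne]
    · subst h; simp [k, d]; norm_num
    · simp [k, d, h.not_gt, h.not_ge, h.ne']
  have i1 : Integrable (Set.indicator (Iic x) (fun _ => (1 : ℝ))) μ :=
    (integrable_const 1).indicator measurableSet_Iic
  have i2 : Integrable (fun y => d x y) μ :=
    integ μ (d_meas.comp measurable_prodMk_left) (d_nonneg x) (d_le x)
  rw [this, integral_sub i1 (i2.const_mul _), integral_indicator measurableSet_Iic,
    integral_const_mul, int_d]
  simp; ring

/-- mid distribution of a law -/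
noncomputable def G (x : ℝ) : ℝ := ∫ y, k x y ∂μ

lemma G_meas : Measurable (G μ) :=
  (k_meas.stronglyMeasurable.integral_prod_right (ν := μ)).measurable

lemma k_int (x : ℝ) : Integrable (fun y => k x y) μ :=
  integ μ (k_meas.comp measurable_prodMk_left) (k_nonneg x) (k_le x)

lemma k_int' (y : ℝ) : Integrable (fun x => k x y) μ :=
  integ μ (k_meas.comp measurable_prodMk_right) (fun x => k_nonneg x y) (fun x => k_le x y)

lemma G_nonneg (x : ℝ) : 0 ≤ G μ x := integral_nonneg (k_nonneg x)
lemma G_le (x : ℝ) : G μ x ≤ 1 := by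
  have := integral_mono (k_int μ x) (integrable_const 1) (k_le x)
  simpa [G] using this

lemma k_swap (x y : ℝ) : k y x = 1 - k x y := by linarith [k_add x y]

lemma int_k' (x : ℝ) : ∫ y, k y x ∂μ = 1 - G μ x := by
  simp_rw [k_swap x]
  rw [integral_sub (integrable_const 1) (k_int μ x)]
  simp [G]

lemma mean : ∫ x, G μ x ∂μ = 1 / 2 := by
  have h : ∫ x, ∫ y, k x y ∂μ ∂μ = ∫ y, ∫ x, k x y ∂μ ∂μ :=
    integral_integral_swap (integ (μ.prod μ) k_meas (fun q => k_nonneg _ _) (fun q => k_le _ _))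
  simp_rw [int_k'] at h
  rw [integral_sub (integrable_const 1) (integ μ (G_meas μ) (G_nonneg μ) (G_le μ))] at h
  simp only [integral_const, probReal_univ, smul_eq_mul] at h
  change ∫ x, G μ x ∂μ = _ at h
  linarith

lemma swapG : ∫ x, ∫ y, k y x * G μ y ∂μ ∂μ = ∫ y, G μ y ^ 2 ∂μ := by
  have h : ∫ x, ∫ y, k y x * G μ y ∂μ ∂μ = ∫ y, ∫ x, k y x * G μ y ∂μ ∂μ := by
    refine integral_integral_swap (f := fun x y => k y x * G μ y)
      (integ (μ.prod μ) ?_ (fun q => ?_) (fun q => ?_))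
    · exact (k_meas.comp measurable_swap).mul ((G_meas μ).comp measurable_snd)
    · exact mul_nonneg (k_nonneg _ _) (G_nonneg μ _)
    · exact mul_le_one₀ (k_le _ _) (G_nonneg μ _) (G_le μ _)
  rw [h]
  congr 1; ext y
  rw [integral_mul_const]
  change G μ y * G μ y = _
  ring

lemma inner_swap (x : ℝ) : ∫ y, ∫ z, k z x * k z y ∂μ ∂μ = ∫ z, k z x * G μ z ∂μ := by
  have h : ∫ y, ∫ z, k z x * k z y ∂μ ∂μ = ∫ z, ∫ y, k z x * k z y ∂μ ∂μ := by
    refine integral_integral_swap (f := fun y z => k z x * k z y)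
      (integ (μ.prod μ) ?_ (fun q => ?_) (fun q => ?_))
    · exact (k_meas.comp (measurable_snd.prodMk measurable_const)).mul (k_meas.comp measurable_swap)
    · exact mul_nonneg (k_nonneg _ _) (k_nonneg _ _)
    · exact mul_le_one₀ (k_le _ _) (k_nonneg _ _) (k_le _ _)
  rw [h]
  congr 1; ext z
  rw [integral_const_mul]; rfl

lemma p_meas : Measurable (fun x : ℝ => μ.real {x}) := by
  have := (d_meas.stronglyMeasurable.integral_prod_right' (ν := μ)).measurable
  simpa only [int_d] using this

/-- inner identity after integrating `z` -/
lemma step_z (x y : ℝ) : k x y * G μ x + k y x * G μ y + ∫ z, k z x * k z y ∂μ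
    = 1 - 1 / 4 * (d x y * μ.real {x}) := by
  have i1 : Integrable (fun z => k x y * k x z) μ := (k_int μ x).const_mul _
  have i2 : Integrable (fun z => k y x * k y z) μ := (k_int μ y).const_mul _
  have i3 : Integrable (fun z => k z x * k z y) μ := integ μ
    ((k_meas.comp measurable_prodMk_right).mul (k_meas.comp measurable_prodMk_right))
    (fun z => mul_nonneg (k_nonneg _ _) (k_nonneg _ _))
    (fun z => mul_le_one₀ (k_le _ _) (k_nonneg _ _) (k_le _ _))
  have i4 : Integrable (fun z => d x z) μ :=
    integ μ (d_meas.comp measurable_prodMk_left) (d_nonneg x) (d_le x)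
  have h : ∫ z, (k x y * k x z + k y x * k y z + k z x * k z y) ∂μ
      = ∫ z, (1 - 1 / 4 * (d x y * d x z)) ∂μ := by simp_rw [k_three]
  have i12 : Integrable (fun z => k x y * k x z + k y x * k y z) μ := i1.add i2
  rw [integral_add i12 i3, integral_add i1 i2, integral_const_mul, integral_const_mul,
    integral_sub (integrable_const 1) ((i4.const_mul _).const_mul _), integral_const_mul,
    integral_const_mul, int_d] at h
  simpa [G] using h

lemma step_y (x : ℝ) : G μ x ^ 2 + ∫ y, k y x * G μ y ∂μ + ∫ y, k y x * G μ y ∂μ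
    = 1 - 1 / 4 * μ.real {x} ^ 2 := by
  have i1 : Integrable (fun y => k x y * G μ x) μ := (k_int μ x).mul_const _
  have i2 : Integrable (fun y => k y x * G μ y) μ := integ μ
    ((k_meas.comp measurable_prodMk_right).mul (G_meas μ))
    (fun z => mul_nonneg (k_nonneg _ _) (G_nonneg μ _))
    (fun z => mul_le_one₀ (k_le _ _) (G_nonneg μ _) (G_le μ _))
  have i4 : Integrable (fun z => d x z) μ :=
    integ μ (d_meas.comp measurable_prodMk_left) (d_nonneg x) (d_le x)
  have e : ∀ y, ∫ z, k z x * k z y ∂μ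
      = 1 - 1 / 4 * (d x y * μ.real {x}) - k x y * G μ x - k y x * G μ y := fun y => by
    linarith [step_z μ x y]
  have h := inner_swap μ x
  simp_rw [e] at h
  have i5 : Integrable (fun y => 1 - 1 / 4 * (d x y * μ.real {x})) μ :=
    (integrable_const 1).sub ((i4.mul_const _).const_mul _)
  have i51 : Integrable (fun y => 1 - 1 / 4 * (d x y * μ.real {x}) - k x y * G μ x) μ := i5.sub i1
  rw [integral_sub i51 i2, integral_sub i5 i1, integral_mul_const,
    integral_sub (integrable_const 1) ((i4.mul_const _).const_mul _), integral_const_mul,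
    integral_mul_const, int_d] at h
  simp only [integral_const, probReal_univ, smul_eq_mul] at h
  change 1 * 1 - 1 / 4 * (μ.real {x} * μ.real {x}) - G μ x * G μ x - _ = _ at h
  linarith

lemma second : 3 * ∫ x, G μ x ^ 2 ∂μ = 1 - 1 / 4 * ∫ x, μ.real {x} ^ 2 ∂μ := by
  have i1 : Integrable (fun x => G μ x ^ 2) μ := integ μ ((G_meas μ).pow_const 2)
    (fun x => sq_nonneg _) (fun x => pow_le_one₀ (G_nonneg μ x) (G_le μ x))
  have i2 : Integrable (fun x => μ.real {x} ^ 2) μ := integ μ ((p_meas μ).pow_const 2)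
    (fun x => sq_nonneg _) (fun x => pow_le_one₀ measureReal_nonneg measureReal_le_one)
  have e : ∀ x, ∫ y, k y x * G μ y ∂μ = 1 / 2 * (1 - 1 / 4 * μ.real {x} ^ 2 - G μ x ^ 2) :=
    fun x => by linarith [step_y μ x]
  have h := swapG μ
  simp_rw [e] at h
  have i3 : Integrable (fun x => 1 - 1 / 4 * μ.real {x} ^ 2) μ :=
    (integrable_const 1).sub (i2.const_mul _)
  rw [integral_const_mul, integral_sub i3 i1,
    integral_sub (integrable_const 1) (i2.const_mul _), integral_const_mul] at h
  simp only [integral_const, probReal_univ, smul_eq_mul] at h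
  linarith

lemma atoms : {x : ℝ | μ.real {x} ≠ 0}.Countable := by
  have := Measure.countable_meas_pos_of_disjoint_iUnion (μ := μ) (As := fun x : ℝ => {x})
    (fun x => measurableSet_singleton x)
    (fun x y h => by simpa [Function.onFun] using h)
  refine this.mono fun x hx => ?_
  simp only [mem_ofPred_eq] at hx ⊢
  refine pos_iff_ne_zero.2 fun h => hx ?_
  simp [Measure.real, h]

lemma tsum_eq : ∑' x : ℝ, μ.real {x} ^ 3 = ∫ x, μ.real {x} ^ 2 ∂μ := by
  have i2 : Integrable (fun x => μ.real {x} ^ 2) μ := integ μ ((p_meas μ).pow_const 2)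
    (fun x => sq_nonneg _) (fun x => pow_le_one₀ measureReal_nonneg measureReal_le_one)
  rw [← setIntegral_eq_integral_of_forall_compl_eq_zero (s := {x : ℝ | μ.real {x} ≠ 0})
    (fun x hx => by simp only [mem_ofPred_eq, not_not] at hx; simp [hx]),
    setIntegral_countable _ (atoms μ) i2.integrableOn,
    ← tsum_subtype_eq_of_support_subset (s := {x : ℝ | μ.real {x} ≠ 0})]
  · congr 1; ext x; simp; ring
  · intro x hx
    simpa using hx

end MidAux

/-- For any real-valued random variable `X` on a probability space,
`Var[F^mid(X;X)] = (1/12)(1 − ∑_x p(x;X)³)`, the sum running over all `x : ℝ`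
(only the countably many atoms contribute); equivalently the sum equals
`E[p(X;X)²]`. -/
theorem variance_midDistrib {Ω : Type*} [MeasurableSpace Ω]
    (P : Measure Ω) [IsProbabilityMeasure P] (X : Ω → ℝ) (hX : Measurable X) :
    ProbabilityTheory.variance (fun ω => midDistrib P X (X ω)) P
      = (1 / 12) * (1 - ∑' x : ℝ, ((P (X ⁻¹' {x})).toReal) ^ 3) ∧
    (∑' x : ℝ, ((P (X ⁻¹' {x})).toReal) ^ 3)
      = ∫ ω, ((P (X ⁻¹' {X ω})).toReal) ^ 2 ∂P := by
  have : IsProbabilityMeasure (P.map X) := Measure.isProbabilityMeasure_map hX.aemeasurable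
  have hp : ∀ x, (P (X ⁻¹' {x})).toReal = (P.map X).real {x} := fun x => by
    rw [Measure.real, Measure.map_apply hX (measurableSet_singleton x)]
  have hG : ∀ x, midDistrib P X x = MidAux.G (P.map X) x := fun x => by
    rw [MidAux.G, MidAux.int_k, midDistrib, hp, Measure.real, Measure.real,
      Measure.map_apply hX measurableSet_Iic]
  simp_rw [hp, hG]
  have gm := MidAux.G_meas (P.map X)
  have e1 : ∫ ω, (P.map X).real {X ω} ^ 2 ∂P = ∫ x, (P.map X).real {x} ^ 2 ∂(P.map X) :=
    (integral_map hX.aemeasurable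
      ((MidAux.p_meas (P.map X)).pow_const 2).aestronglyMeasurable).symm
  have e2 : ∫ ω, MidAux.G (P.map X) (X ω) ∂P = ∫ x, MidAux.G (P.map X) x ∂(P.map X) :=
    (integral_map hX.aemeasurable gm.aestronglyMeasurable).symm
  have e3 : ∫ ω, MidAux.G (P.map X) (X ω) ^ 2 ∂P = ∫ x, MidAux.G (P.map X) x ^ 2 ∂(P.map X) :=
    (integral_map hX.aemeasurable (gm.pow_const 2).aestronglyMeasurable).symm
  have hm : MemLp (fun ω => MidAux.G (P.map X) (X ω)) 2 P :=
    MemLp.of_bound (gm.comp hX).aestronglyMeasurable 1 (Filter.Eventually.of_forall fun ω => by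
      rw [Real.norm_eq_abs, abs_of_nonneg (MidAux.G_nonneg _ _)]; exact MidAux.G_le _ _)
  refine ⟨?_, by rw [e1, MidAux.tsum_eq]⟩
  rw [ProbabilityTheory.variance_eq_sub hm, MidAux.tsum_eq, e2, MidAux.mean]
  simp only [Pi.pow_apply]
  rw [e3]
  linarith [MidAux.second (P.map X)]
end

section
/- Let X be a real-valued random variable and Y an integrable real-valued random variable on a probability space (Ω, 𝒜, P), and let F(·;X) be the distribution function of X. Then the conditional expectation of Y given the σ-algebra generated by X equals, P-almost surely, the conditional expectation of Y given the σ-algebra generated by the rank transform F(X;X): E[Y | σ(X)] = E[Y | σ(F(X;X))] a.s. -/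
open MeasureTheory Set

/-- The distribution function `F(x;X) = P(X ≤ x)`. -/
noncomputable def distFun {Ω : Type*} [MeasurableSpace Ω] (P : Measure Ω)
    (X : Ω → ℝ) (x : ℝ) : ℝ :=
  (P (X ⁻¹' Iic x)).toReal

theorem rank_null {Ω : Type*} [MeasurableSpace Ω]
    (P : Measure Ω) [IsProbabilityMeasure P] (X : Ω → ℝ) (hX : Measurable X) (a : ℝ) :
    P (X ⁻¹' {x | a < x ∧ distFun P X x = distFun P X a}) = 0 := by
  have hI : ∀ x, a < x → distFun P X x = distFun P X a → (P.map X) (Ioc a x) = 0 := by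
    intro x hx h
    rw [Measure.map_apply hX measurableSet_Ioc, show Ioc a x = Iic x \ Iic a by ext; simp [and_comm], preimage_diff,
      measure_diff (preimage_mono (Iic_subset_Iic.2 hx.le))
        (hX measurableSet_Iic).nullMeasurableSet (measure_ne_top _ _)]
    have := (ENNReal.toReal_eq_toReal_iff' (measure_ne_top _ _) (measure_ne_top _ _)).1 h
    rw [this, tsub_self]
  set S := {x | a < x ∧ distFun P X x = distFun P X a} with hS
  have h0 : (P.map X) S = 0 := by
    refine measure_null_of_locally_null S fun x hx => ?_
    by_cases h : ∃ y ∈ S, x < y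
    · obtain ⟨y, hy, hxy⟩ := h
      exact ⟨Ioc a y, mem_nhdsWithin_of_mem_nhds (Ioc_mem_nhds hx.1 hxy), hI y hy.1 hy.2⟩
    · push Not at h
      exact ⟨Ioc a x, Filter.mem_of_superset self_mem_nhdsWithin
        fun y hy => ⟨hy.1, h y hy⟩, hI x hx.1 hx.2⟩
  exact Measure.preimage_null_of_map_null hX.aemeasurable h0

theorem distFun_mono {Ω : Type*} [MeasurableSpace Ω]
    (P : Measure Ω) [IsProbabilityMeasure P] (X : Ω → ℝ) : Monotone (distFun P X) := by
  intro x y h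
  exact ENNReal.toReal_mono (measure_ne_top _ _)
    (measure_mono (preimage_mono (Iic_subset_Iic.2 h)))

/-- For integrable `Y`, the conditional expectation of `Y` given
`σ(X)` coincides `P`-a.s. with the conditional expectation of `Y` given the
σ-algebra generated by the rank transform `F(X;X)`. -/
theorem condexp_rank_transform {Ω : Type*} [MeasurableSpace Ω]
    (P : Measure Ω) [IsProbabilityMeasure P] (X : Ω → ℝ) (hX : Measurable X)
    (Y : Ω → ℝ) (hY : Integrable Y P) :
    P[Y | MeasurableSpace.comap X Real.measurableSpace]
      =ᵐ[P]
    P[Y | MeasurableSpace.comap (fun ω => distFun P X (X ω)) Real.measurableSpace] := by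
  have hF := (distFun_mono P X).measurable
  have hmX : MeasurableSpace.comap (fun ω => distFun P X (X ω)) Real.measurableSpace ≤
      MeasurableSpace.comap X Real.measurableSpace := by
    rintro s ⟨t, ht, rfl⟩
    exact ⟨distFun P X ⁻¹' t, hF ht, rfl⟩
  have hX' := hX.comap_le
  have key : Measurable[eventuallyMeasurableSpace
      (MeasurableSpace.comap (fun ω => distFun P X (X ω)) Real.measurableSpace) (ae P)] X := by
    refine @measurable_of_Iic ℝ Ω _ _ _ (eventuallyMeasurableSpace
      (MeasurableSpace.comap (fun ω => distFun P X (X ω)) Real.measurableSpace) (ae P)) _ _ _ X fun a => ?_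
    refine ⟨(fun ω => distFun P X (X ω)) ⁻¹' Iic (distFun P X a), ⟨_, measurableSet_Iic, rfl⟩, ?_⟩
    have h : ∀ᵐ ω ∂P, ¬ (a < X ω ∧ distFun P X (X ω) = distFun P X a) := by
      rw [ae_iff]
      simpa using rank_null P X hX a
    filter_upwards [h] with ω hω
    apply propext
    change X ω ≤ a ↔ distFun P X (X ω) ≤ distFun P X a
    refine ⟨fun h => distFun_mono P X h, fun h => ?_⟩
    by_contra hc
    push Not at hc
    exact hω ⟨hc, le_antisymm h (distFun_mono P X hc.le)⟩
  symm
  refine ae_eq_condExp_of_forall_setIntegral_eq hX' hY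
    (fun s _ _ => integrable_condExp.integrableOn) ?_
    (stronglyMeasurable_condExp.mono hmX).aestronglyMeasurable
  rintro s ⟨u, hu, rfl⟩ -
  obtain ⟨t, ht, hst⟩ := key hu
  rw [setIntegral_congr_set hst, setIntegral_congr_set hst,
    setIntegral_condExp (hmX.trans hX') hY ht]
end

section
/- Let X be a real-valued random variable and Y an integrable real-valued random variable on a probability space (Ω, 𝒜, P), and let F^mid(·;X) be the mid-distribution function of X. Then E[Y | σ(X)] = E[Y | σ(F^mid(X;X))] P-almost surely. -/
open MeasureTheory Set

theorem mid_key {Ω : Type*} [MeasurableSpace Ω]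
    (P : Measure Ω) [IsProbabilityMeasure P] (X : Ω → ℝ) (hX : Measurable X) {x y : ℝ}
    (h : x < y) :
    P.real (X ⁻¹' Ioc x y) / 2 ≤ midDistrib P X y - midDistrib P X x := by
  have h1 : P.real (X ⁻¹' Iic y) = P.real (X ⁻¹' Iic x) + P.real (X ⁻¹' Ioc x y) := by
    rw [← Iic_union_Ioc_eq_Iic h.le, preimage_union]
    refine measureReal_union ?_ (hX measurableSet_Ioc)
    refine Disjoint.preimage X ?_
    exact Set.disjoint_left.2 fun z hz hz' => absurd hz'.1 (not_lt.2 hz)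
  have h2 : P.real (X ⁻¹' {y}) ≤ P.real (X ⁻¹' Ioc x y) := by
    refine measureReal_mono (preimage_mono ?_)
    rintro z rfl
    exact ⟨h, le_rfl⟩
  have h3 : 0 ≤ P.real (X ⁻¹' {x}) := measureReal_nonneg
  unfold midDistrib
  simp only [Measure.real] at h1 h2 h3 ⊢
  linarith

theorem mid_mono {Ω : Type*} [MeasurableSpace Ω]
    (P : Measure Ω) [IsProbabilityMeasure P] (X : Ω → ℝ) (hX : Measurable X) :
    Monotone (midDistrib P X) := by
  intro x y h
  rcases h.eq_or_lt with rfl | h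
  · exact le_rfl
  have := mid_key P X hX h
  have h3 : 0 ≤ P.real (X ⁻¹' Ioc x y) := measureReal_nonneg
  linarith

theorem mid_null {Ω : Type*} [MeasurableSpace Ω]
    (P : Measure Ω) [IsProbabilityMeasure P] (X : Ω → ℝ) (hX : Measurable X) (a : ℝ) :
    P (X ⁻¹' {x | a < x ∧ midDistrib P X x ≤ midDistrib P X a}) = 0 := by
  set S : Set ℝ := {x | a < x ∧ midDistrib P X x ≤ midDistrib P X a} with hS
  have hG := (mid_mono P X hX).measurable
  have hSm : MeasurableSet S :=
    measurableSet_Ioi.inter (measurableSet_le hG measurable_const)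
  rw [← Measure.map_apply hX hSm]
  have h0 : ∀ x ∈ S, P.map X (Ioc a x) = 0 := by
    intro x hx
    rw [Measure.map_apply hX measurableSet_Ioc]
    have := mid_key P X hX hx.1
    have h3 : 0 ≤ P.real (X ⁻¹' Ioc a x) := measureReal_nonneg
    rw [← measureReal_eq_zero_iff]
    linarith [hx.2]
  refine measure_null_of_locally_null S fun x hx => ?_
  by_cases hm : ∃ y ∈ S, x < y
  · obtain ⟨y, hy, hxy⟩ := hm
    exact ⟨Ioc a y, mem_nhdsWithin_of_mem_nhds (Ioc_mem_nhds hx.1 hxy), h0 y hy⟩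
  · push Not at hm
    exact ⟨Ioc a x, Filter.mem_of_superset self_mem_nhdsWithin
      fun z hz => ⟨hz.1, hm z hz⟩, h0 x hx⟩

theorem mid_exists {Ω : Type*} [MeasurableSpace Ω]
    (P : Measure Ω) [IsProbabilityMeasure P] (X : Ω → ℝ) (hX : Measurable X) (B : Set ℝ)
    (hB : MeasurableSet B) : ∃ C : Set ℝ, MeasurableSet C ∧
      X ⁻¹' B =ᵐ[P] (fun ω => midDistrib P X (X ω)) ⁻¹' C := by
  have hgen := borel_eq_generateFrom_Iic ℝ
  rw [← BorelSpace.measurable_eq (α := ℝ)] at hgen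
  rw [hgen] at hB
  induction hB with
  | basic u hu =>
    obtain ⟨a, rfl⟩ := hu
    refine ⟨Iic (midDistrib P X a), measurableSet_Iic, ?_⟩
    have hn := measure_eq_zero_iff_ae_notMem.1 (mid_null P X hX a)
    filter_upwards [hn] with ω hω
    apply propext
    change X ω ≤ a ↔ midDistrib P X (X ω) ≤ midDistrib P X a
    refine ⟨fun h => mid_mono P X hX h, fun h => ?_⟩
    by_contra h'
    exact hω ⟨not_le.1 h', h⟩
  | empty => exact ⟨∅, MeasurableSet.empty, by simp⟩
  | compl t _ ih =>
    obtain ⟨C, hC, h⟩ := ih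
    exact ⟨Cᶜ, hC.compl, by simpa only [preimage_compl] using h.compl⟩
  | iUnion f _ ih =>
    choose C hC h using ih
    refine ⟨⋃ n, C n, MeasurableSet.iUnion hC, ?_⟩
    simp only [preimage_iUnion]
    exact Filter.EventuallyEq.countable_iUnion h

/-- For integrable `Y`, the conditional expectation of `Y` given
`σ(X)` coincides `P`-a.s. with the conditional expectation of `Y` given the
σ-algebra generated by the mid-rank transform `F^mid(X;X)`. -/
theorem condexp_mid_rank_transform {Ω : Type*} [MeasurableSpace Ω]
    (P : Measure Ω) [IsProbabilityMeasure P] (X : Ω → ℝ) (hX : Measurable X)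
    (Y : Ω → ℝ) (hY : Integrable Y P) :
    P[Y | MeasurableSpace.comap X Real.measurableSpace]
      =ᵐ[P]
    P[Y | MeasurableSpace.comap (fun ω => midDistrib P X (X ω)) Real.measurableSpace] := by
  have hG := (mid_mono P X hX).measurable
  have hGX : Measurable (fun ω => midDistrib P X (X ω)) := hG.comp hX
  have hle : MeasurableSpace.comap (fun ω => midDistrib P X (X ω)) Real.measurableSpace
      ≤ MeasurableSpace.comap X Real.measurableSpace := by
    rintro _ ⟨C, hC, rfl⟩
    exact ⟨midDistrib P X ⁻¹' C, hG hC, rfl⟩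
  symm
  refine ae_eq_condExp_of_forall_setIntegral_eq hX.comap_le hY
    (fun _ _ _ => integrable_condExp.integrableOn) ?_
    (stronglyMeasurable_condExp.mono hle).aestronglyMeasurable
  rintro _ ⟨B, hB, rfl⟩ _
  obtain ⟨C, hC, h⟩ := mid_exists P X hX B hB
  rw [setIntegral_congr_set h, setIntegral_congr_set h]
  exact setIntegral_condExp hGX.comap_le hY ⟨C, hC, rfl⟩
end

section
/- Let X be an integrable real-valued random variable with continuous distribution function F(·;X), and let X' be an independent copy of X. Then E[X · (F(X;X) − 1/2)] = (1/4) · E[|X − X'|]. -/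
open MeasureTheory Set

/-- (Gini.) If `X` is integrable with continuous distribution
function and `X'` is an independent copy of `X`, then
`E[X·(F(X;X) − 1/2)] = (1/4)·E[|X − X'|]`. -/
theorem gini_identity {Ω : Type*} [MeasurableSpace Ω]
    (P : Measure Ω) [IsProbabilityMeasure P] (X X' : Ω → ℝ)
    (hX : Measurable X) (hX' : Measurable X')
    (hint : Integrable X P) (hF : Continuous (distFun P X))
    (hindep : ProbabilityTheory.IndepFun X X' P)
    (hid : Measure.map X' P = Measure.map X P) :
    ∫ ω, X ω * (distFun P X (X ω) - 1 / 2) ∂P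
      = (1 / 4) * ∫ ω, |X ω - X' ω| ∂P := by
  classical
  set μ := Measure.map X P with hμ
  have : IsProbabilityMeasure μ := Measure.isProbabilityMeasure_map hX.aemeasurable
  have hFμ : ∀ x, distFun P X x = μ.real (Iic x) := by
    intro x
    rw [distFun, Measure.real, hμ, Measure.map_apply hX measurableSet_Iic]
  have hcdf : ⇑(ProbabilityTheory.cdf μ) = distFun P X := by
    ext x
    rw [hFμ, ProbabilityTheory.cdf_eq_real]
  have hatom : ∀ x, μ {x} = 0 := by
    intro x
    rw [← ProbabilityTheory.measure_cdf μ, StieltjesFunction.measure_singleton]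
    have h1 : ContinuousAt (ProbabilityTheory.cdf μ) x := by
      rw [hcdf]; exact hF.continuousAt
    rw [h1.continuousWithinAt.leftLim_eq]
    simp
  have hIci : ∀ x, μ.real (Ici x) = 1 - μ.real (Iic x) := by
    intro x
    have h1 : μ.real (Iio x) = μ.real (Iic x) := by
      rw [Measure.real, Measure.real]
      congr 1
      have : NullSingletonClass μ := ⟨hatom⟩
      exact measure_congr Iio_ae_eq_Iic
    rw [← h1, ← compl_Iio, probReal_compl_eq_one_sub measurableSet_Iio]
  have hintμ : Integrable (fun x : ℝ => x) μ := by
    rw [hμ, integrable_map_measure (by fun_prop) hX.aemeasurable]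
    exact hint
  let A : Set (ℝ × ℝ) := {p | p.2 ≤ p.1}
  have hA : MeasurableSet A := measurableSet_le measurable_snd measurable_fst
  let s : ℝ × ℝ → ℝ := fun p => 2 * A.indicator (fun _ => (1 : ℝ)) p - 1
  have hs : Measurable s := ((measurable_const.indicator hA).const_mul 2).sub_const 1
  have hsb : ∀ p, ‖s p‖ ≤ 1 := by
    intro p
    by_cases hp : p ∈ A <;> simp [s, hp] <;> norm_num
  have hi1 : Integrable (fun p : ℝ × ℝ => s p * p.1) (μ.prod μ) :=
    (hintμ.comp_fst μ).bdd_mul hs.aestronglyMeasurable (Filter.Eventually.of_forall hsb)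
  have hi2 : Integrable (fun p : ℝ × ℝ => s p * p.2) (μ.prod μ) :=
    (hintμ.comp_snd μ).bdd_mul hs.aestronglyMeasurable (Filter.Eventually.of_forall hsb)
  have habs : ∀ p : ℝ × ℝ, |p.1 - p.2| = s p * p.1 - s p * p.2 := by
    intro p
    by_cases hp : p ∈ A
    · have : p.2 ≤ p.1 := hp
      simp only [s, indicator_of_mem hp]
      rw [abs_of_nonneg (by linarith)]; ring
    · have : p.1 < p.2 := not_le.mp hp
      simp only [s, indicator_of_notMem hp]
      rw [abs_of_neg (by linarith)]; ring
  have hs1 : ∀ x, ∫ y, s (x, y) ∂μ = 2 * μ.real (Iic x) - 1 := by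
    intro x
    have : ∀ y, s (x, y) = 2 * (Iic x).indicator (fun _ => (1:ℝ)) y - 1 := by
      intro y; simp [s, A, indicator]
    simp_rw [this]
    rw [integral_sub (((integrable_const _).indicator measurableSet_Iic).const_mul 2)
      (integrable_const _), integral_const_mul, integral_indicator_const _ measurableSet_Iic]
    simp
  have hs2 : ∀ y, ∫ x, s (x, y) ∂μ = 1 - 2 * μ.real (Iic y) := by
    intro x
    have : ∀ y, s (y, x) = 2 * (Ici x).indicator (fun _ => (1:ℝ)) y - 1 := by
      intro y; simp [s, A, indicator]
    simp_rw [this]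
    rw [integral_sub (((integrable_const _).indicator measurableSet_Ici).const_mul 2)
      (integrable_const _), integral_const_mul, integral_indicator_const _ measurableSet_Ici, hIci]
    simp
    ring
  have hprod : Measure.map (fun ω => (X ω, X' ω)) P = μ.prod μ := by
    rw [(ProbabilityTheory.indepFun_iff_map_prod_eq_prod_map_map hX.aemeasurable
      hX'.aemeasurable).1 hindep, hid]
  have hR : ∫ ω, |X ω - X' ω| ∂P = ∫ p : ℝ × ℝ, |p.1 - p.2| ∂(μ.prod μ) := by
    rw [← hprod, integral_map (hX.prodMk hX').aemeasurable (by fun_prop)]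
  have hL : ∫ ω, X ω * (distFun P X (X ω) - 1 / 2) ∂P
      = ∫ x, x * (distFun P X x - 1 / 2) ∂μ := by
    rw [hμ, integral_map hX.aemeasurable]
    exact (continuous_id.mul (hF.sub continuous_const)).aestronglyMeasurable
  rw [hL, hR]
  simp_rw [habs]
  rw [integral_sub hi1 hi2, integral_prod _ hi1, integral_prod_symm _ hi2]
  simp only [integral_mul_const, hs1, hs2, ← hFμ]
  have e1 : ∀ x, (2 * distFun P X x - 1) * x = 2 * (x * (distFun P X x - 1 / 2)) := by
    intro x; ring
  have e2 : ∀ x, (1 - 2 * distFun P X x) * x = (-2) * (x * (distFun P X x - 1 / 2)) := by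
    intro x; ring
  simp_rw [e1, e2]
  rw [integral_const_mul, integral_const_mul]
  ring
end
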